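/- There do not exist: a nondegenerate interval I ⊆ ℝ containing 0, a twice-differentiable function a : I → ℝ with a(τ) > 0 for all τ, a(0) = 1 and a'(0) = 0, and real constants k ≠ 0, f₊, f_{R+} ≠ 0, c ≠ 0 such that for all τ ∈ I: (i) a(τ)·a''(τ) + a'(τ)² + k = 0; (ii) a''(τ)/a(τ) = −2(a'(τ)² + k)/a(τ)² + f₊/(2 f_{R+}); and (iii) (a'(τ)² + k)/a(τ)² = (1/f_{R+})·(c/(6 a(τ)³) + f₊/6). -/

import Mathlib

/-- Impossibility of Oppenheimer–Snyder collapse in nonlinear metric f(R) gravity: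
no dust FLRW scale factor with `k ≠ 0` and standard initial conditions can satisfy
both the third junction condition with a Schwarzschild exterior (`R⁻ = 0`) and the
f(R) equations of motion at constant scalar curvature. -/
theorem stmt3 : ¬ ∃ (I : Set ℝ) (a a' a'' : ℝ → ℝ) (k fp fRp c : ℝ),
    Convex ℝ I ∧ (0 : ℝ) ∈ I ∧ (∃ τ ∈ I, τ ≠ 0) ∧
    (∀ τ ∈ I, HasDerivAt a (a' τ) τ) ∧
    (∀ τ ∈ I, HasDerivAt a' (a'' τ) τ) ∧
    (∀ τ ∈ I, 0 < a τ) ∧ a 0 = 1 ∧ a' 0 = 0 ∧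
    k ≠ 0 ∧ fRp ≠ 0 ∧ c ≠ 0 ∧
    (∀ τ ∈ I, a τ * a'' τ + (a' τ) ^ 2 + k = 0) ∧
    (∀ τ ∈ I,
      a'' τ / a τ = -2 * ((a' τ) ^ 2 + k) / (a τ) ^ 2 + fp / (2 * fRp)) ∧
    (∀ τ ∈ I, ((a' τ) ^ 2 + k) / (a τ) ^ 2
      = (1 / fRp) * (c / (6 * (a τ) ^ 3) + fp / 6)) := by
  rintro ⟨I, a, a', a'', k, fp, fRp, c, hI, h0, ⟨t, ht, htne⟩, -, ha', hpos, ha0, ha'0,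
    hk, hf, -, h1, h2, h3⟩
  have hF : ∀ τ ∈ I, (a' τ) ^ 2 + k = fp / (2 * fRp) * (a τ) ^ 2 := by
    intro τ hτ
    have hne := (hpos τ hτ).ne'
    have e1 := h1 τ hτ
    have e2 := h2 τ hτ
    have e4 : a'' τ = -((a' τ) ^ 2 + k) / a τ := by
      rw [eq_div_iff hne]
      linarith
    rw [e4] at e2
    field_simp at e2 ⊢
    linarith
  have hk' : k = fp / (2 * fRp) := by simpa [ha0, ha'0] using hF 0 h0
  have hfp : fp = 2 * fRp * k := by
    rw [hk']
    field_simp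
  have hcube : ∀ τ ∈ I, 4 * fRp * k * (a τ) ^ 3 = c := by
    intro τ hτ
    have hne := (hpos τ hτ).ne'
    have e3 := h3 τ hτ
    rw [hF τ hτ, ← hk', hfp] at e3
    field_simp at e3
    linarith
  have hone : ∀ τ ∈ I, a τ = 1 := by
    intro τ hτ
    have hne : 4 * fRp * k ≠ 0 := by positivity
    have h : (a τ) ^ 3 = 1 := by
      apply mul_left_cancel₀ hne
      rw [hcube τ hτ, ← hcube 0 h0, ha0, one_pow]
    exact (pow_eq_one_iff_of_nonneg (hpos τ hτ).le three_ne_zero).mp h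
  have hzero : ∀ τ ∈ I, a' τ = 0 := by
    intro τ hτ
    have h := hF τ hτ
    rw [← hk', hone τ hτ] at h
    exact pow_eq_zero_iff two_ne_zero |>.mp (by linarith)
  have hder : ∀ τ ∈ I, HasDerivWithinAt a' (-k) I τ := by
    intro τ hτ
    have h := h1 τ hτ
    rw [hone τ hτ, hzero τ hτ] at h
    have e : a'' τ = -k := by linarith
    exact e ▸ (ha' τ hτ).hasDerivWithinAt
  have hlin : ∀ τ ∈ I, HasDerivWithinAt (fun x => a' x + k * x) 0 I τ := by
    intro τ hτ
    have h := (hder τ hτ).fun_add ((hasDerivWithinAt_id τ I).const_mul k)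
    rwa [mul_one, neg_add_cancel] at h
  have hconst := hI.norm_image_sub_le_of_norm_hasDerivWithin_le (C := 0) hlin
    (fun _ _ => norm_zero.le) h0 ht
  have hle : ‖k * t‖ ≤ 0 := by simpa [hzero t ht, ha'0] using hconst
  exact mul_ne_zero hk htne (norm_le_zero_iff.mp hle)
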